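/- arXiv:1812.02201 — 11 statements merged into one kernel-verified Lean document; each statement's English description precedes it below -/
import Mathlib

section
/- Let σ, b > 0 and 0 < r < 1. Every differentiable solution u : [0,∞) → ℝ³ of the Lorenz system converges to the origin: u(t) → (0,0,0) as t → ∞. In other words, for 0 < r < 1 the equilibrium S₀ = (0,0,0) is globally asymptotically stable. -/
open Filter

/-- For `σ, b > 0` and `0 < r < 1`, every differentiable solution of the Lorenz system on
`[0,∞)` converges to the origin: the equilibrium `S₀ = (0,0,0)` is globally
asymptotically stable. -/
theorem lorenz_global_asymptotic_stability (σ b r : ℝ) (hσ : 0 < σ) (hb : 0 < b)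
    (hr0 : 0 < r) (hr1 : r < 1) (x y z : ℝ → ℝ)
    (hx : ∀ t : ℝ, 0 ≤ t → HasDerivAt x (-σ * (x t - y t)) t)
    (hy : ∀ t : ℝ, 0 ≤ t → HasDerivAt y (r * x t - y t - x t * z t) t)
    (hz : ∀ t : ℝ, 0 ≤ t → HasDerivAt z (-b * z t + x t * y t) t) :
    Tendsto (fun t => (x t, y t, z t)) atTop (nhds ((0 : ℝ), (0 : ℝ), (0 : ℝ))) := by
  obtain ⟨c, hc, hc1, hc2, hc3⟩ : ∃ c : ℝ, 0 < c ∧ c ≤ (1 - r) * σ ∧ c ≤ 1 - r ∧ c ≤ 2 * b := by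
    have h1 : 0 < 1 - r := by linarith
    refine ⟨min ((1 - r) * σ) (min (1 - r) (2 * b)), by positivity, min_le_left _ _, ?_, ?_⟩
    · exact (min_le_right _ _).trans (min_le_left _ _)
    · exact (min_le_right _ _).trans (min_le_right _ _)
  set V : ℝ → ℝ := fun t => x t ^ 2 + σ * (y t ^ 2 + z t ^ 2) with hV
  have hW : ∀ t : ℝ, 0 ≤ t → HasDerivAt (fun t => V t * Real.exp (c * t))
      ((2 * x t * (-σ * (x t - y t)) + σ * (2 * y t * (r * x t - y t - x t * z t)
        + 2 * z t * (-b * z t + x t * y t)) + c * V t) * Real.exp (c * t)) t := by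
    intro t ht
    have hexp : HasDerivAt (fun t => Real.exp (c * t)) (Real.exp (c * t) * (c * 1)) t :=
      ((hasDerivAt_id t).const_mul c).exp
    have hVd := (((hx t ht).pow 2).add
      ((((hy t ht).pow 2).add ((hz t ht).pow 2)).const_mul σ)).mul hexp
    refine hVd.congr_deriv ?_
    simp [hV]
    ring
  have hanti : AntitoneOn (fun t => V t * Real.exp (c * t)) (Set.Ici 0) := by
    apply antitoneOn_of_deriv_nonpos (convex_Ici 0)
    · exact fun t ht => (hW t ht).continuousAt.continuousWithinAt
    · intro t ht
      rw [interior_Ici] at ht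
      exact (hW t (le_of_lt ht)).differentiableAt.differentiableWithinAt
    · intro t ht
      rw [interior_Ici] at ht
      rw [(hW t (le_of_lt ht)).deriv]
      refine mul_nonpos_of_nonpos_of_nonneg ?_ (Real.exp_pos _).le
      simp only [hV]
      have e1 := mul_le_mul_of_nonneg_right hc1 (sq_nonneg (x t))
      have e2 := mul_le_mul_of_nonneg_right hc2 (mul_nonneg hσ.le (sq_nonneg (y t)))
      have e3 := mul_le_mul_of_nonneg_right hc3 (mul_nonneg hσ.le (sq_nonneg (z t)))
      have e4 : 0 ≤ (1 + r) * σ * (x t - y t) ^ 2 := by positivity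
      nlinarith
  have hbd : ∀ t : ℝ, 0 ≤ t → V t ≤ V 0 * Real.exp (-(c * t)) := by
    intro t ht
    have h := hanti (Set.mem_Ici.2 le_rfl) (Set.mem_Ici.2 ht) ht
    simp only [mul_zero, Real.exp_zero, mul_one] at h
    rw [Real.exp_neg, ← div_eq_mul_inv, le_div_iff₀ (Real.exp_pos _)]
    exact h
  have hlim : Tendsto (fun t => V 0 * Real.exp (-(c * t))) atTop (nhds 0) := by
    have := (Real.tendsto_exp_neg_atTop_nhds_zero.comp
      (tendsto_id.const_mul_atTop hc)).const_mul (V 0)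
    simpa [Function.comp_def] using this
  have hV0 : Tendsto V atTop (nhds 0) := by
    refine tendsto_of_tendsto_of_tendsto_of_le_of_le' tendsto_const_nhds hlim ?_ ?_
    · exact Eventually.of_forall fun t => by simp only [hV]; positivity
    · filter_upwards [eventually_ge_atTop 0] with t ht using hbd t ht
  have key : ∀ (f : ℝ → ℝ) (k : ℝ), (∀ t, f t ^ 2 ≤ k * V t) → Tendsto f atTop (nhds 0) := by
    intro f k h
    have h2 : Tendsto (fun t => Real.sqrt (k * V t)) atTop (nhds 0) := by
      have := (Real.continuous_sqrt.tendsto _).comp (hV0.const_mul k)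
      simpa [Function.comp_def] using this
    exact squeeze_zero_norm (fun t => Real.abs_le_sqrt (h t)) h2
  refine (key x 1 fun t => ?_).prodMk_nhds
    ((key y σ⁻¹ fun t => ?_).prodMk_nhds (key z σ⁻¹ fun t => ?_))
  · simp only [hV, one_mul]
    have : 0 ≤ σ * (y t ^ 2 + z t ^ 2) := by positivity
    linarith
  · rw [le_inv_mul_iff₀ hσ]
    simp only [hV]
    nlinarith [sq_nonneg (x t), mul_nonneg hσ.le (sq_nonneg (z t))]
  · rw [le_inv_mul_iff₀ hσ]
    simp only [hV]
    nlinarith [sq_nonneg (x t), mul_nonneg hσ.le (sq_nonneg (y t))]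
end

section
/- Let b > 0, σ > b + 1, and r > 1. Every complex root of the polynomial λ³ + (σ + b + 1)λ² + b(σ + r)λ + 2σb(r−1) has negative real part if and only if r < σ(σ + b + 3)/(σ − b − 1). Consequently, the equilibria S_± of the Lorenz system are linearly stable exactly for 1 < r < σ(σ + b + 3)/(σ − b − 1). -/
theorem cubic_hurwitz (A B C : ℝ) (hA : 0 < A) (hB : 0 < B) (hC : 0 < C) :
    (∀ z : ℂ, z ^ 3 + (A : ℂ) * z ^ 2 + (B : ℂ) * z + (C : ℂ) = 0 → z.re < 0) ↔ C < A * B := by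
  constructor
  · intro h
    by_contra! hle
    have hcont : ContinuousOn (fun t : ℝ => t ^ 3 + A * t ^ 2 + B * t + C)
        (Set.Icc (-(A + C + 1)) (-A)) := by fun_prop
    have hiv := intermediate_value_Icc (by linarith : -(A + C + 1) ≤ -A) hcont
    have h0 : (0 : ℝ) ∈ Set.Icc ((-(A + C + 1)) ^ 3 + A * (-(A + C + 1)) ^ 2 + B * (-(A + C + 1)) + C)
        ((-A) ^ 3 + A * (-A) ^ 2 + B * (-A) + C) := by
      constructor
      · have h1 : 1 ≤ (A + C + 1) ^ 2 := by nlinarith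
        have h2 : C + 1 ≤ (A + C + 1) ^ 2 * (C + 1) := by nlinarith
        have h3 : 0 < B * (A + C + 1) := by positivity
        nlinarith
      · nlinarith
    obtain ⟨t, ⟨_, ht⟩, hroot⟩ := hiv h0
    simp only at hroot
    obtain ⟨w, hw⟩ := IsAlgClosed.exists_pow_nat_eq
      (((A + t) ^ 2 - 4 * (B + t * (A + t)) : ℝ) : ℂ) (n := 2) (by norm_num)
    have hrootC : (t : ℂ) ^ 3 + A * (t : ℂ) ^ 2 + B * t + C = 0 := by exact_mod_cast hroot
    push_cast at hw
    have key : ∀ v : ℂ, v ^ 2 = ((A : ℂ) + t) ^ 2 - 4 * (B + t * (A + t)) → v.re < 0 := by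
      intro v hv
      have := h ((-((A : ℂ) + t) + v) / 2) (by
        linear_combination ((-((A : ℂ) + t) + v) / 2 - t) / 4 * hv + hrootC)
      have e : ((-((A : ℂ) + t) + v) / 2).re = (-(A + t) + v.re) / 2 := by
        simp
      rw [e] at this
      linarith
    have h1 := key w hw
    have h2 := key (-w) (by rw [neg_sq]; exact hw)
    simp at h2
    linarith
  · intro h z hz
    by_contra! hx
    have hre := congrArg Complex.re hz
    have him := congrArg Complex.im hz
    simp [pow_succ] at hre him
    generalize z.re = x at *
    generalize z.im = y at *
    by_cases hy : y = 0
    · subst hy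
      have : 0 ≤ x ^ 3 + A * x ^ 2 + B * x := by positivity
      nlinarith
    · have e : y ^ 2 = 3 * x ^ 2 + 2 * A * x + B := by
        apply mul_left_cancel₀ hy
        linear_combination -him
      have : 0 ≤ 8 * x ^ 3 + 8 * A * x ^ 2 + 2 * B * x + 2 * A ^ 2 * x := by positivity
      have : C - A * B = 8 * x ^ 3 + 8 * A * x ^ 2 + 2 * B * x + 2 * A ^ 2 * x := by
        linear_combination hre + (3 * x + A) * e
      linarith


/-- Routh–Hurwitz criterion for the Lorenz equilibria `S₊, S₋`: for `b > 0`, `σ > b + 1`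
and `r > 1`, all complex roots of `λ³ + (σ+b+1)λ² + b(σ+r)λ + 2σb(r−1)` have negative
real part if and only if `r < σ(σ+b+3)/(σ−b−1)`. -/
theorem lorenz_Spm_stability_criterion (σ b r : ℝ) (hb : 0 < b) (hσ : b + 1 < σ)
    (hr : 1 < r) :
    (∀ z : ℂ,
        z ^ 3 + ((σ : ℂ) + (b : ℂ) + 1) * z ^ 2 + (b : ℂ) * ((σ : ℂ) + (r : ℂ)) * z +
            2 * (σ : ℂ) * (b : ℂ) * ((r : ℂ) - 1) = 0 →
          z.re < 0) ↔
      r < σ * (σ + b + 3) / (σ - b - 1) := by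
  have hσ0 : 0 < σ := by linarith
  have hr1 : 0 < r - 1 := by linarith
  have hr0 : 0 < r := by linarith
  have H := cubic_hurwitz (σ + b + 1) (b * (σ + r)) (2 * σ * b * (r - 1))
    (by positivity) (by positivity) (by positivity)
  push_cast at H
  rw [H, lt_div_iff₀ (by linarith)]
  constructor
  · intro h
    have : b * (r * (σ - b - 1)) < b * (σ * (σ + b + 3)) := by linarith
    exact lt_of_mul_lt_mul_left this hb.le
  · intro h
    have := mul_lt_mul_of_pos_left h hb
    linarith
end

section
/- Let B, C > 0 and p = 0. If (x, y, z) : ℝ → ℝ³ is a differentiable solution of the Vallis system with p = 0, then the function (X, Y, Z) defined by X(t) = x(t), Y(t) = (B/C)·y(t), Z(t) = (B/C)·(1 − z(t)) is a solution of the Lorenz system Ẋ = −σ(X − Y), Ẏ = rX − Y − XZ, Ż = −bZ + XY with parameters σ = C, r = B/C, b = 1. -/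
/-- For `p = 0`, the change of variables `X = x`, `Y = (B/C)y`, `Z = (B/C)(1 − z)` maps
solutions of the Vallis system to solutions of the Lorenz system with parameters
`σ = C`, `r = B/C`, `b = 1`. -/
theorem vallis_to_lorenz (B C : ℝ) (hB : 0 < B) (hC : 0 < C) (x y z : ℝ → ℝ)
    (hx : ∀ t : ℝ, HasDerivAt x (B * y t - C * (x t + 0)) t)
    (hy : ∀ t : ℝ, HasDerivAt y (x t * z t - y t) t)
    (hz : ∀ t : ℝ, HasDerivAt z (-(x t * y t) - z t + 1) t) :
    let X : ℝ → ℝ := fun t => x t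
    let Y : ℝ → ℝ := fun t => (B / C) * y t
    let Z : ℝ → ℝ := fun t => (B / C) * (1 - z t)
    (∀ t : ℝ, HasDerivAt X (-C * (X t - Y t)) t) ∧
      (∀ t : ℝ, HasDerivAt Y ((B / C) * X t - Y t - X t * Z t) t) ∧
      (∀ t : ℝ, HasDerivAt Z (-(1 : ℝ) * Z t + X t * Y t) t) := by
  intro X Y Z
  have hC0 : C ≠ 0 := hC.ne'
  refine ⟨fun t => ?_, fun t => ?_, fun t => ?_⟩
  · refine (hx t).congr_deriv ?_
    simp only [X, Y]
    field_simp
    ring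
  · refine ((hy t).const_mul (B / C)).congr_deriv ?_
    simp only [X, Y, Z]
    ring
  · refine (((hz t).const_sub 1).const_mul (B / C)).congr_deriv ?_
    simp only [X, Y, Z]
    ring
end

section
/- Let B, C > 0 and p ∈ ℝ. A point (x, y, z) ∈ ℝ³ with x ≠ 0 is an equilibrium of the Vallis system if and only if x³ + p·x² + (1 − B/C)·x + p = 0, y = C(x + p)/B, and z = C(x + p)/(Bx). Moreover, if p ≠ 0, then every equilibrium of the Vallis system has x ≠ 0. -/
/-- Characterization of the equilibria of the Vallis system with `x ≠ 0`: such a point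
`(x,y,z)` is an equilibrium iff `x³ + px² + (1 − B/C)x + p = 0`, `y = C(x+p)/B`,
`z = C(x+p)/(Bx)`. Moreover, if `p ≠ 0`, every equilibrium has `x ≠ 0`. -/
theorem vallis_equilibria_characterization (B C p : ℝ) (hB : 0 < B) (hC : 0 < C) :
    (∀ x y z : ℝ, x ≠ 0 →
        ((B * y - C * (x + p) = 0 ∧ x * z - y = 0 ∧ -(x * y) - z + 1 = 0) ↔
          (x ^ 3 + p * x ^ 2 + (1 - B / C) * x + p = 0 ∧
            y = C * (x + p) / B ∧ z = C * (x + p) / (B * x)))) ∧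
      (p ≠ 0 →
        ∀ x y z : ℝ,
          (B * y - C * (x + p) = 0 ∧ x * z - y = 0 ∧ -(x * y) - z + 1 = 0) → x ≠ 0) := by
  have hB' : B ≠ 0 := hB.ne'
  have hC' : C ≠ 0 := hC.ne'
  refine ⟨?_, ?_⟩
  · intro x y z hx
    have key : C * (x ^ 3 + p * x ^ 2 + (1 - B / C) * x + p)
        = C * x ^ 3 + C * p * x ^ 2 + (C - B) * x + C * p := by
      field_simp
    constructor
    · rintro ⟨h1, h2, h3⟩
      refine ⟨?_, ?_, ?_⟩
      · apply mul_left_cancel₀ hC'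
        rw [key]
        linear_combination (-(x ^ 2 + 1)) * h1 - B * x * h3 - B * h2
      · rw [eq_div_iff hB']
        linear_combination h1
      · rw [eq_div_iff (mul_ne_zero hB' hx)]
        linear_combination h1 + B * h2
    · rintro ⟨h0, hy, hz⟩
      rw [h0] at key
      rw [eq_div_iff hB'] at hy
      rw [eq_div_iff (mul_ne_zero hB' hx)] at hz
      refine ⟨?_, ?_, ?_⟩
      · linear_combination hy
      · apply mul_left_cancel₀ hB'
        linear_combination hz - hy
      · apply mul_left_cancel₀ (mul_ne_zero hB' hx)
        linear_combination key - x ^ 2 * hy - hz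
  · rintro hp x y z ⟨h1, h2, h3⟩ rfl
    apply mul_ne_zero hC' hp
    linear_combination -h1 - B * h2
end

section
/- Let 0 < B < C and let p ∈ ℝ be arbitrary. Then the Vallis system has exactly one equilibrium; equivalently, there is exactly one point (x, y, z) ∈ ℝ³ at which the vector field (By − C(x+p), xz − y, −xy − z + 1) vanishes. -/
/-- For `0 < B < C` and arbitrary real `p`, the Vallis system has exactly one
equilibrium. -/
theorem vallis_unique_equilibrium (B C p : ℝ) (hB : 0 < B) (hBC : B < C) :
    ∃! u : ℝ × ℝ × ℝ,
      B * u.2.1 - C * (u.1 + p) = 0 ∧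
        u.1 * u.2.2 - u.2.1 = 0 ∧
        -(u.1 * u.2.1) - u.2.2 + 1 = 0 := by
  have hpos : ∀ x : ℝ, 0 < 1 + x ^ 2 := fun x => by positivity
  have hle : ∀ x : ℝ, x / (1 + x ^ 2) ≤ 1 := fun x => by
    rw [div_le_one (hpos x)]; nlinarith [sq_nonneg (x - 1)]
  have hge : ∀ x : ℝ, -1 ≤ x / (1 + x ^ 2) := fun x => by
    rw [le_div_iff₀ (hpos x)]; nlinarith [sq_nonneg (x + 1)]
  have hcont : Continuous (fun x : ℝ => B * (x / (1 + x ^ 2)) - C * (x + p)) := by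
    have : Continuous (fun x : ℝ => x / (1 + x ^ 2)) :=
      Continuous.div (by fun_prop) (by fun_prop) (fun x => (hpos x).ne')
    fun_prop
  have hex : ∃ x : ℝ, B * (x / (1 + x ^ 2)) - C * (x + p) = 0 := by
    have h := intermediate_value_Icc' (show -p - 1 ≤ -p + 1 by linarith) hcont.continuousOn
    obtain ⟨x, -, hx⟩ := h (show (0 : ℝ) ∈ _ from
      ⟨by nlinarith [hle (-p + 1)], by nlinarith [hge (-p - 1)]⟩)
    exact ⟨x, hx⟩
  have hsol : ∀ x y z : ℝ, x * z - y = 0 → -(x * y) - z + 1 = 0 →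
      z = 1 / (1 + x ^ 2) ∧ y = x / (1 + x ^ 2) := by
    intro x y z h1 h2
    have hy : y = x * z := by linarith
    subst hy
    have hz : z = 1 / (1 + x ^ 2) := by
      rw [eq_div_iff (hpos x).ne']; linarith
    refine ⟨hz, ?_⟩
    rw [hz]; ring
  obtain ⟨a, ha⟩ := hex
  refine ⟨(a, a / (1 + a ^ 2), 1 / (1 + a ^ 2)), ⟨ha, ?_, ?_⟩, ?_⟩
  · simp only; ring
  · have := (hpos a).ne'
    simp only
    field_simp
    ring
  · rintro ⟨x, y, z⟩ ⟨h1, h2, h3⟩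
    simp only at h1 h2 h3
    obtain ⟨hz, hy⟩ := hsol x y z h2 h3
    have hxa : x = a := by
      by_contra hne
      rw [hy] at h1
      have hD : 0 < (1 + x ^ 2) * (1 + a ^ 2) := mul_pos (hpos x) (hpos a)
      have e : x / (1 + x ^ 2) - a / (1 + a ^ 2)
          = (x - a) * (1 - x * a) / ((1 + x ^ 2) * (1 + a ^ 2)) := by
        have := (hpos a).ne'
        have := (hpos x).ne'
        field_simp
        ring
      have e2 : B * (x / (1 + x ^ 2) - a / (1 + a ^ 2)) = C * (x - a) := by linarith
      rw [e, ← mul_div_assoc, div_eq_iff hD.ne'] at e2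
      have e3 : B * (1 - x * a) = C * ((1 + x ^ 2) * (1 + a ^ 2)) :=
        mul_left_cancel₀ (sub_ne_zero.mpr hne) (by linarith)
      have e4 : 1 - x * a ≤ (1 + x ^ 2) * (1 + a ^ 2) := by
        nlinarith [sq_nonneg (x + a), sq_nonneg x, sq_nonneg a, sq_nonneg (x * a)]
      have e5 := mul_le_mul_of_nonneg_left e4 hB.le
      have e6 := mul_lt_mul_of_pos_right hBC hD
      linarith
    subst hxa
    rw [hy, hz]
end

section
/- Let B > C > 0 and p ∈ ℝ. Define Q = (p/3)(2p²/9 + B/C + 2), P = −(p²/3 + B/C − 1), D = Q²/4 + P³/27, and p* = √((B²/(8C²) − 5B/(2C) − 1) + (1/8)·√((B/C)·(B/C + 8)³)). Then the quantity under the outer square root defining p* is nonnegative, and D < 0 if and only if |p| < p*. -/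
/-- For `B > C > 0`, with `Q = (p/3)(2p²/9 + B/C + 2)`, `P = −(p²/3 + B/C − 1)`,
`D = Q²/4 + P³/27` and
`p* = √((B²/(8C²) − 5B/(2C) − 1) + (1/8)√((B/C)(B/C + 8)³))`, the quantity under the
outer square root is nonnegative and `D < 0 ↔ |p| < p*`. -/
theorem vallis_discriminant_criterion (B C p : ℝ) (hC : 0 < C) (hBC : C < B) :
    let Q : ℝ := (p / 3) * (2 * p ^ 2 / 9 + B / C + 2)
    let P : ℝ := -(p ^ 2 / 3 + B / C - 1)
    let D : ℝ := Q ^ 2 / 4 + P ^ 3 / 27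
    let pstar : ℝ :=
      Real.sqrt ((B ^ 2 / (8 * C ^ 2) - 5 * B / (2 * C) - 1) +
        (1 / 8) * Real.sqrt ((B / C) * (B / C + 8) ^ 3))
    0 ≤ (B ^ 2 / (8 * C ^ 2) - 5 * B / (2 * C) - 1) +
        (1 / 8) * Real.sqrt ((B / C) * (B / C + 8) ^ 3) ∧
      (D < 0 ↔ |p| < pstar) := by
  intro Q P D pstar
  obtain ⟨b, hb⟩ : ∃ b, b = B / C := ⟨_, rfl⟩
  have hb1 : 1 < b := by rw [hb]; exact (one_lt_div hC).mpr hBC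
  have hm : B ^ 2 / (8 * C ^ 2) - 5 * B / (2 * C) - 1 = b ^ 2 / 8 - 5 * b / 2 - 1 := by
    rw [hb]; field_simp
  have hpos : 0 ≤ b * (b + 8) ^ 3 := by positivity
  obtain ⟨r, hr⟩ : ∃ r, r = Real.sqrt (b * (b + 8) ^ 3) := ⟨_, rfl⟩
  have hr0 : 0 ≤ r := by rw [hr]; exact Real.sqrt_nonneg _
  have hr2 : r ^ 2 = b * (b + 8) ^ 3 := by rw [hr]; exact Real.sq_sqrt hpos
  have hc : 0 < (b - 1) ^ 3 := pow_pos (by linarith) 3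
  have habs : |b ^ 2 - 20 * b - 8| < r := by
    apply abs_lt_of_sq_lt_sq _ hr0
    rw [hr2]; nlinarith
  obtain ⟨h1, h2⟩ := abs_lt.mp habs
  have hps : pstar = Real.sqrt ((b ^ 2 / 8 - 5 * b / 2 - 1) + 1 / 8 * r) := by
    simp only [pstar]; rw [hm, ← hb, ← hr]
  have hD : D = 1 / 27 * (p ^ 2 - (b ^ 2 / 8 - 5 * b / 2 - 1) + 1 / 8 * r) *
      (p ^ 2 - ((b ^ 2 / 8 - 5 * b / 2 - 1) + 1 / 8 * r)) := by
    simp only [D, Q, P]; rw [← hb]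
    linear_combination (1 / 1728) * hr2
  have hf : 0 < 1 / 27 * (p ^ 2 - (b ^ 2 / 8 - 5 * b / 2 - 1) + 1 / 8 * r) := by
    nlinarith [sq_nonneg p]
  constructor
  · rw [hm, ← hb, ← hr]; linarith
  · rw [hD, hps, Real.lt_sqrt (abs_nonneg p), sq_abs, mul_neg_iff]
    constructor
    · rintro (⟨_, h⟩ | ⟨h, _⟩) <;> linarith
    · intro h; exact Or.inl ⟨hf, by linarith⟩
end

section
/- Let B > C > 0 and p ∈ ℝ with |p| < p*, where p* = √((B²/(8C²) − 5B/(2C) − 1) + (1/8)·√((B/C)·(B/C + 8)³)). Then the cubic x³ + p·x² + (1 − B/C)·x + p = 0 has three distinct real roots, and the Vallis system has exactly three equilibria. -/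
/-- Existence of the turning point of `g(x) = -x + kx/(1+x²)`. -/
lemma vallis_turning (k p : ℝ) (hk : 1 < k)
    (hp : |p| < Real.sqrt ((k ^ 2 / 8 - 5 * k / 2 - 1) +
        (1 / 8) * Real.sqrt (k * (k + 8) ^ 3))) :
    ∃ a : ℝ, 0 < a ∧ a ^ 3 + p * a ^ 2 + (1 - k) * a + p < 0 ∧
      0 < (-a) ^ 3 + p * (-a) ^ 2 + (1 - k) * (-a) + p := by
  obtain ⟨s, hs⟩ : ∃ s, s = Real.sqrt (k * (k + 8)) := ⟨_, rfl⟩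
  have hs0 : 0 ≤ s := hs ▸ Real.sqrt_nonneg _
  have hs2 : s ^ 2 = k * (k + 8) := by
    rw [hs]; exact Real.sq_sqrt (by nlinarith)
  have h1 : Real.sqrt (k * (k + 8) ^ 3) = (k + 8) * s := by
    rw [Real.sqrt_eq_iff_mul_self_eq (by positivity) (by positivity)]
    linear_combination (-(k + 8) ^ 2) * hs2
  have hsk : k + 2 < s := by
    apply lt_of_pow_lt_pow_left₀ 2 hs0
    nlinarith
  obtain ⟨a, ha⟩ : ∃ a, a = Real.sqrt ((s - k - 2) / 2) := ⟨_, rfl⟩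
  have ha0 : 0 < a := by rw [ha]; apply Real.sqrt_pos.2; linarith
  have ha2 : a ^ 2 = (s - k - 2) / 2 := by
    rw [ha]; exact Real.sq_sqrt (by linarith)
  have hq : 0 < a * ((s + k - 4) / 4) := by apply mul_pos ha0; linarith
  have h2 : Real.sqrt ((k ^ 2 / 8 - 5 * k / 2 - 1) +
        (1 / 8) * Real.sqrt (k * (k + 8) ^ 3)) = a * ((s + k - 4) / 4) := by
    rw [h1, ← Real.sqrt_sq hq.le]
    congr 1
    rw [mul_pow, ha2]
    linear_combination (-(s + k - 10) / 32) * hs2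
  rw [h2] at hp
  obtain ⟨hp1, hp2⟩ := abs_lt.1 hp
  have key : a ^ 3 + (1 - k) * a = - ((a ^ 2 + 1) * (a * ((s + k - 4) / 4))) := by
    have : a ^ 3 = a * a ^ 2 := by ring
    rw [this, ha2]
    linear_combination (a / 8) * hs2
  refine ⟨a, ha0, ?_, ?_⟩
  · have := mul_pos (show 0 < a ^ 2 + 1 by positivity) (sub_pos.2 hp2)
    nlinarith
  · have := mul_pos (show 0 < a ^ 2 + 1 by positivity) (sub_pos.2 hp1)
    nlinarith

lemma vallis_roots (k p a : ℝ) (hk : 1 < k) (ha : 0 < a)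
    (h1 : a ^ 3 + p * a ^ 2 + (1 - k) * a + p < 0)
    (h2 : 0 < (-a) ^ 3 + p * (-a) ^ 2 + (1 - k) * (-a) + p) :
    ∃ x₁ x₂ x₃ : ℝ, x₁ ≠ x₂ ∧ x₁ ≠ x₃ ∧ x₂ ≠ x₃ ∧
        (∀ x : ℝ, x ^ 3 + p * x ^ 2 + (1 - k) * x + p = 0 ↔
          x = x₁ ∨ x = x₂ ∨ x = x₃) := by
  obtain ⟨f, hf⟩ : ∃ f : ℝ → ℝ, f = fun x => x ^ 3 + p * x ^ 2 + (1 - k) * x + p := ⟨_, rfl⟩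
  have hc : Continuous f := by rw [hf]; fun_prop
  obtain ⟨M, hM⟩ : ∃ M, M = 1 + |p| + k + a := ⟨_, rfl⟩
  have hpa := neg_abs_le p
  have hpb := le_abs_self p
  have hMa : a < M := by linarith [abs_nonneg p]
  have hM1 : 0 < f M := by
    have : 0 ≤ (M + p - (1 + k)) * (1 + M ^ 2) := mul_nonneg (by linarith) (by positivity)
    rw [hf]
    nlinarith [mul_nonneg (show 0 ≤ k by linarith) (sq_nonneg (M - 1)), sq_nonneg M,
      mul_nonneg (show 0 ≤ k by linarith) (sq_nonneg M)]
  have hM2 : f (-M) < 0 := by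
    have : 0 ≤ (M - p - (1 + k)) * (1 + M ^ 2) := mul_nonneg (by linarith) (by positivity)
    rw [hf]
    nlinarith [mul_nonneg (show 0 ≤ k by linarith) (sq_nonneg (M - 1)), sq_nonneg M,
      mul_nonneg (show 0 ≤ k by linarith) (sq_nonneg M)]
  have g1 : f a < 0 := by rw [hf]; exact h1
  have g2 : 0 < f (-a) := by rw [hf]; exact h2
  obtain ⟨x₁, ⟨l1, u1⟩, e1⟩ := intermediate_value_Ioo (show -M ≤ -a by linarith)
    hc.continuousOn ⟨hM2, g2⟩
  obtain ⟨x₂, ⟨l2, u2⟩, e2⟩ := intermediate_value_Ioo' (show -a ≤ a by linarith)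
    hc.continuousOn ⟨g1, g2⟩
  obtain ⟨x₃, ⟨l3, u3⟩, e3⟩ := intermediate_value_Ioo (show a ≤ M by linarith)
    hc.continuousOn ⟨g1, hM1⟩
  have n12 : x₁ ≠ x₂ := (u1.trans l2).ne
  have n13 : x₁ ≠ x₃ := ((u1.trans l2).trans (u2.trans l3)).ne
  have n23 : x₂ ≠ x₃ := (u2.trans l3).ne
  simp only [hf] at e1 e2 e3
  refine ⟨x₁, x₂, x₃, n12, n13, n23, fun x => ⟨fun hx => ?_, ?_⟩⟩
  · by_contra! hne
    obtain ⟨m1, m2, m3⟩ := hne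
    have d2 : x₁ ^ 2 + x₁ * x₂ + x₂ ^ 2 + p * (x₁ + x₂) + (1 - k) = 0 :=
      mul_left_cancel₀ (sub_ne_zero.2 n12) (by linear_combination e1 - e2)
    have d3 : x₁ ^ 2 + x₁ * x₃ + x₃ ^ 2 + p * (x₁ + x₃) + (1 - k) = 0 :=
      mul_left_cancel₀ (sub_ne_zero.2 n13) (by linear_combination e1 - e3)
    have d : x₁ ^ 2 + x₁ * x + x ^ 2 + p * (x₁ + x) + (1 - k) = 0 :=
      mul_left_cancel₀ (sub_ne_zero.2 m1.symm) (by linear_combination e1 - hx)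
    have c3 : x₁ + x₂ + x₃ + p = 0 :=
      mul_left_cancel₀ (sub_ne_zero.2 n23) (by linear_combination d2 - d3)
    have c : x₁ + x₂ + x + p = 0 :=
      mul_left_cancel₀ (sub_ne_zero.2 m2.symm) (by linear_combination d2 - d)
    exact m3 (by linarith)
  · rintro (rfl | rfl | rfl) <;> assumption

/-- For `B > C > 0` and `|p| < p*`, the cubic `x³ + px² + (1 − B/C)x + p` has three
distinct real roots, and the Vallis system has exactly three equilibria. -/
theorem vallis_three_equilibria (B C p : ℝ) (hC : 0 < C) (hBC : C < B)
    (hp : |p| <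
      Real.sqrt ((B ^ 2 / (8 * C ^ 2) - 5 * B / (2 * C) - 1) +
        (1 / 8) * Real.sqrt ((B / C) * (B / C + 8) ^ 3))) :
    (∃ x₁ x₂ x₃ : ℝ, x₁ ≠ x₂ ∧ x₁ ≠ x₃ ∧ x₂ ≠ x₃ ∧
        (∀ x : ℝ, x ^ 3 + p * x ^ 2 + (1 - B / C) * x + p = 0 ↔
          x = x₁ ∨ x = x₂ ∨ x = x₃)) ∧
      ({u : ℝ × ℝ × ℝ |
          B * u.2.1 - C * (u.1 + p) = 0 ∧
            u.1 * u.2.2 - u.2.1 = 0 ∧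
            -(u.1 * u.2.1) - u.2.2 + 1 = 0}.encard = 3) := by
  have hB : 0 < B := hC.trans hBC
  have hk : 1 < B / C := (one_lt_div hC).2 hBC
  have e : B ^ 2 / (8 * C ^ 2) - 5 * B / (2 * C) - 1 =
      (B / C) ^ 2 / 8 - 5 * (B / C) / 2 - 1 := by
    field_simp
  rw [e] at hp
  obtain ⟨a, ha, h1, h2⟩ := vallis_turning (B / C) p hk hp
  obtain ⟨x₁, x₂, x₃, n12, n13, n23, h⟩ := vallis_roots (B / C) p a hk ha h1 h2
  refine ⟨⟨x₁, x₂, x₃, n12, n13, n23, h⟩, ?_⟩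
  obtain ⟨F, hF⟩ : ∃ F : ℝ → ℝ × ℝ × ℝ,
      F = fun x => (x, C * (x + p) / B, 1 - x * (C * (x + p) / B)) := ⟨_, rfl⟩
  have hinj : Function.Injective F := by
    intro x y hxy
    rw [hF] at hxy
    exact congrArg Prod.fst hxy
  have hset : {u : ℝ × ℝ × ℝ |
          B * u.2.1 - C * (u.1 + p) = 0 ∧
            u.1 * u.2.2 - u.2.1 = 0 ∧
            -(u.1 * u.2.1) - u.2.2 + 1 = 0} = F '' {x₁, x₂, x₃} := by
    ext ⟨x, y, z⟩
    simp only [Set.mem_setOf_eq, Set.mem_image]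
    constructor
    · rintro ⟨q1, q2, q3⟩
      have hy : y = C * (x + p) / B := by
        rw [eq_div_iff hB.ne']; linarith
      have hz : z = 1 - x * y := by linarith
      refine ⟨x, (h x).1 ?_, ?_⟩
      · rw [hz] at q2
        field_simp
        linear_combination (-(1 + x ^ 2)) * q1 - B * q2
      · rw [hF, hz, hy]
    · rintro ⟨t, ht, hFT⟩
      have hr := (h t).2 ht
      rw [hF] at hFT
      simp only [Prod.mk.injEq] at hFT
      obtain ⟨rfl, rfl, rfl⟩ := hFT
      field_simp at hr
      refine ⟨by field_simp; ring, ?_, by ring⟩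
      field_simp
      linear_combination -hr
  rw [hset, hinj.encard_image]
  exact Set.encard_eq_three.2 ⟨x₁, x₂, x₃, n12, n13, n23, rfl⟩
end

section
/- Let B, C > 0 and p ∈ ℝ. If u = (x, y, z) : ℝ → ℝ³ is a differentiable solution of the Vallis system, then the function V(t) = x(t)²/B + y(t)² + (z(t) + 1)² is differentiable and satisfies d/dt V(t) = −2·((C/B)·x(t)² + (Cp/B)·x(t) + y(t)² + z(t)² − 1) for all t. -/
/-- Along any differentiable solution of the Vallis system, the Lyapunov function
`V(t) = x(t)²/B + y(t)² + (z(t)+1)²` is differentiable with derivative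
`−2((C/B)x² + (Cp/B)x + y² + z² − 1)`. -/
theorem vallis_lyapunov_derivative (B C p : ℝ) (hB : 0 < B) (hC : 0 < C) (x y z : ℝ → ℝ)
    (hx : ∀ t : ℝ, HasDerivAt x (B * y t - C * (x t + p)) t)
    (hy : ∀ t : ℝ, HasDerivAt y (x t * z t - y t) t)
    (hz : ∀ t : ℝ, HasDerivAt z (-(x t * y t) - z t + 1) t) :
    ∀ t : ℝ,
      HasDerivAt (fun s => (x s) ^ 2 / B + (y s) ^ 2 + (z s + 1) ^ 2)
        (-2 * ((C / B) * (x t) ^ 2 + (C * p / B) * x t + (y t) ^ 2 + (z t) ^ 2 - 1)) t := by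
  intro t
  have h := ((((hx t).fun_pow 2).div_const B).fun_add ((hy t).fun_pow 2)).fun_add
    (((hz t).add_const 1).fun_pow 2)
  refine h.congr_deriv ?_
  have hB' : B ≠ 0 := hB.ne'
  field_simp
  push_cast
  ring
end

section
/- Let B > 0, C > 1/2, and p ∈ ℝ. For all real x, y, z one has (C/B)·x² + (Cp/B)·x + y² + z² − 1 ≥ (1/2)·(x²/B + y² + (z+1)² − 4 − (Cp)²/((2C−1)B)). -/
/-- The key estimate for the Vallis Lyapunov function: for `B > 0`, `C > 1/2`, `p ∈ ℝ`
and all real `x, y, z`,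
`(C/B)x² + (Cp/B)x + y² + z² − 1 ≥ (1/2)(x²/B + y² + (z+1)² − 4 − (Cp)²/((2C−1)B))`. -/
theorem vallis_key_inequality (B C p : ℝ) (hB : 0 < B) (hC : 1 / 2 < C) :
    ∀ x y z : ℝ,
      (C / B) * x ^ 2 + (C * p / B) * x + y ^ 2 + z ^ 2 - 1 ≥
        (1 / 2) * (x ^ 2 / B + y ^ 2 + (z + 1) ^ 2 - 4 - (C * p) ^ 2 / ((2 * C - 1) * B)) := by
  intro x y z
  have hD : 0 < 2 * C - 1 := by linarith
  have key : (C / B) * x ^ 2 + (C * p / B) * x + y ^ 2 + z ^ 2 - 1 -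
        (1 / 2) * (x ^ 2 / B + y ^ 2 + (z + 1) ^ 2 - 4 - (C * p) ^ 2 / ((2 * C - 1) * B)) =
      ((2 * C - 1) * x + C * p) ^ 2 / (2 * ((2 * C - 1) * B)) + y ^ 2 / 2 + (z - 1) ^ 2 / 2 := by
    have hB' : B ≠ 0 := hB.ne'
    have hD' : 2 * C - 1 ≠ 0 := hD.ne'
    obtain ⟨D, hDC⟩ : ∃ D, D = 2 * C - 1 := ⟨_, rfl⟩
    have hCD : C = (D + 1) / 2 := by linarith
    rw [← hDC] at hD' ⊢
    subst hCD
    field_simp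
    ring
  have h : 0 ≤ ((2 * C - 1) * x + C * p) ^ 2 / (2 * ((2 * C - 1) * B)) + y ^ 2 / 2
      + (z - 1) ^ 2 / 2 := by
    have := mul_pos hD hB
    positivity
  linarith
end

section
/- Let B > 0, C > 1/2, and p ∈ ℝ, and set R² = 4 + (Cp)²/((2C−1)B). Then every differentiable solution u = (x, y, z) : [0,∞) → ℝ³ of the Vallis system satisfies limsup_{t→∞} (x(t)²/B + y(t)² + (z(t)+1)²) ≤ R². In particular the ellipsoid 𝓑 = {(x,y,z) ∈ ℝ³ : x²/B + y² + (z+1)² ≤ R²} is a global absorbing set and the Vallis system is dissipative in the sense of Levinson. -/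
open Filter

/-- Dissipativity of the Vallis system: for `B > 0`, `C > 1/2`, `p ∈ ℝ` and
`R² = 4 + (Cp)²/((2C−1)B)`, every differentiable solution on `[0,∞)` satisfies
`limsup_{t→∞} (x(t)²/B + y(t)² + (z(t)+1)²) ≤ R²`; i.e. the ellipsoid
`{x²/B + y² + (z+1)² ≤ R²}` is a global absorbing set. -/
theorem vallis_dissipative (B C p : ℝ) (hB : 0 < B) (hC : 1 / 2 < C) (x y z : ℝ → ℝ)
    (hx : ∀ t : ℝ, 0 ≤ t → HasDerivAt x (B * y t - C * (x t + p)) t)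
    (hy : ∀ t : ℝ, 0 ≤ t → HasDerivAt y (x t * z t - y t) t)
    (hz : ∀ t : ℝ, 0 ≤ t → HasDerivAt z (-(x t * y t) - z t + 1) t) :
    Filter.limsup (fun t => (x t) ^ 2 / B + (y t) ^ 2 + (z t + 1) ^ 2) atTop ≤
      4 + (C * p) ^ 2 / ((2 * C - 1) * B) := by
  set R : ℝ := 4 + (C * p) ^ 2 / ((2 * C - 1) * B) with hR
  set V : ℝ → ℝ := fun t => (x t) ^ 2 / B + (y t) ^ 2 + (z t + 1) ^ 2 with hV
  have hD : 0 < 2 * C - 1 := by linarith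
  have hVd : ∀ t : ℝ, 0 ≤ t → HasDerivAt V
      (-2 * C * x t ^ 2 / B - 2 * C * p * x t / B - 2 * y t ^ 2 + 2 - 2 * z t ^ 2) t := by
    intro t ht
    have h := ((((hx t ht).pow 2).div_const B).add ((hy t ht).pow 2)).add
      (((hz t ht).add_const 1).pow 2)
    refine h.congr_deriv ?_
    field_simp
    push_cast
    ring
  have key : ∀ t : ℝ,
      (-2 * C * x t ^ 2 / B - 2 * C * p * x t / B - 2 * y t ^ 2 + 2 - 2 * z t ^ 2)
        + (V t - R) ≤ 0 := by
    intro t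
    have e : (-2 * C * x t ^ 2 / B - 2 * C * p * x t / B - 2 * y t ^ 2 + 2 - 2 * z t ^ 2)
        + (V t - R) =
        -(((2 * C - 1) * x t + C * p) ^ 2 / ((2 * C - 1) * B) + y t ^ 2 + (z t - 1) ^ 2) := by
      simp only [hV, hR]
      field_simp
      ring
    rw [e]
    have : 0 ≤ ((2 * C - 1) * x t + C * p) ^ 2 / ((2 * C - 1) * B) + y t ^ 2 + (z t - 1) ^ 2 := by
      positivity
    linarith
  have hg : ∀ t : ℝ, 0 ≤ t → HasDerivAt (fun t => Real.exp t * (V t - R))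
      (Real.exp t * (V t - R) + Real.exp t *
      (-2 * C * x t ^ 2 / B - 2 * C * p * x t / B - 2 * y t ^ 2 + 2 - 2 * z t ^ 2)) t :=
    fun t ht => (Real.hasDerivAt_exp t).mul ((hVd t ht).sub_const R)
  have hanti : AntitoneOn (fun t => Real.exp t * (V t - R)) (Set.Ici 0) := by
    apply antitoneOn_of_deriv_nonpos (convex_Ici 0)
    · exact fun t ht => (hg t ht).continuousAt.continuousWithinAt
    · intro t ht
      rw [interior_Ici] at ht
      exact (hg t (le_of_lt ht)).differentiableAt.differentiableWithinAt
    · intro t ht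
      rw [interior_Ici] at ht
      rw [(hg t (le_of_lt ht)).deriv, ← mul_add]
      exact mul_nonpos_of_nonneg_of_nonpos (Real.exp_pos t).le (by linarith [key t])
  have hbound : ∀ᶠ t in atTop, V t ≤ R + Real.exp (-t) * (V 0 - R) := by
    filter_upwards [eventually_ge_atTop 0] with t ht
    have h := hanti (Set.mem_Ici.2 le_rfl) (Set.mem_Ici.2 ht) ht
    simp only [Real.exp_zero, one_mul] at h
    have h2 := mul_le_mul_of_nonneg_left h (Real.exp_pos (-t)).le
    rw [← mul_assoc, ← Real.exp_add, neg_add_cancel, Real.exp_zero, one_mul] at h2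
    linarith
  have hlim : Tendsto (fun t : ℝ => R + Real.exp (-t) * (V 0 - R)) atTop (nhds R) := by
    have h := (Real.tendsto_exp_neg_atTop_nhds_zero.mul_const (V 0 - R)).const_add R
    simpa using h
  have hV0 : ∀ t, 0 ≤ V t := fun t => by simp only [hV]; positivity
  rw [← hlim.limsup_eq]
  exact limsup_le_limsup hbound
    (isCoboundedUnder_le_of_le atTop (x := 0) hV0) hlim.isBoundedUnder_le
end

section
/- Let B > 0, C > 1/2, and p ∈ ℝ, and set R² = 4 + (Cp)²/((2C−1)B). If u = (x, y, z) : [0,∞) → ℝ³ is a differentiable solution of the Vallis system with x(0)²/B + y(0)² + (z(0)+1)² ≤ R², then x(t)²/B + y(t)² + (z(t)+1)² ≤ R² for all t ≥ 0; that is, the ellipsoid 𝓑 = {(x,y,z) ∈ ℝ³ : x²/B + y² + (z+1)² ≤ R²} is positively invariant. -/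
/-- Positive invariance of the absorbing ellipsoid of the Vallis system: for `B > 0`,
`C > 1/2`, `p ∈ ℝ` and `R² = 4 + (Cp)²/((2C−1)B)`, if a differentiable solution on `[0,∞)`
starts with `x(0)²/B + y(0)² + (z(0)+1)² ≤ R²`, then
`x(t)²/B + y(t)² + (z(t)+1)² ≤ R²` for all `t ≥ 0`. -/
theorem vallis_ellipsoid_positively_invariant (B C p : ℝ) (hB : 0 < B) (hC : 1 / 2 < C)
    (x y z : ℝ → ℝ)
    (hx : ∀ t : ℝ, 0 ≤ t → HasDerivAt x (B * y t - C * (x t + p)) t)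
    (hy : ∀ t : ℝ, 0 ≤ t → HasDerivAt y (x t * z t - y t) t)
    (hz : ∀ t : ℝ, 0 ≤ t → HasDerivAt z (-(x t * y t) - z t + 1) t)
    (h0 : (x 0) ^ 2 / B + (y 0) ^ 2 + (z 0 + 1) ^ 2 ≤ 4 + (C * p) ^ 2 / ((2 * C - 1) * B)) :
    ∀ t : ℝ, 0 ≤ t →
      (x t) ^ 2 / B + (y t) ^ 2 + (z t + 1) ^ 2 ≤ 4 + (C * p) ^ 2 / ((2 * C - 1) * B) := by
  intro t ht
  have hk : 0 < 2 * C - 1 := by linarith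
  set R := 4 + (C * p) ^ 2 / ((2 * C - 1) * B) with hR
  have hd : ∀ s : ℝ, 0 ≤ s → HasDerivAt
      (fun s => ((x s) ^ 2 / B + (y s) ^ 2 + (z s + 1) ^ 2 - R) * Real.exp s)
      ((-(2 * C * (x s) ^ 2 / B) - 2 * C * p * x s / B - 2 * (y s) ^ 2 + 2 - 2 * (z s) ^ 2
        + ((x s) ^ 2 / B + (y s) ^ 2 + (z s + 1) ^ 2 - R)) * Real.exp s) s := by
    intro s hs
    have h := ((((((hx s hs).pow 2).div_const B).add ((hy s hs).pow 2)).add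
      (((hz s hs).add_const 1).pow 2)).sub_const R).mul (Real.hasDerivAt_exp s)
    refine h.congr_deriv ?_
    simp only [Pi.add_apply, Pi.pow_apply]
    field_simp
    ring
  have hanti : AntitoneOn
      (fun s => ((x s) ^ 2 / B + (y s) ^ 2 + (z s + 1) ^ 2 - R) * Real.exp s) (Set.Ici 0) := by
    apply antitoneOn_of_deriv_nonpos (convex_Ici 0)
    · exact fun s hs => (hd s hs).continuousAt.continuousWithinAt
    · intro s hs
      exact (hd s (interior_subset hs)).differentiableAt.differentiableWithinAt
    · intro s hs
      rw [(hd s (interior_subset hs)).deriv]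
      apply mul_nonpos_of_nonpos_of_nonneg _ (Real.exp_pos s).le
      have e : -(2 * C * (x s) ^ 2 / B) - 2 * C * p * x s / B - 2 * (y s) ^ 2 + 2 - 2 * (z s) ^ 2
          + ((x s) ^ 2 / B + (y s) ^ 2 + (z s + 1) ^ 2 - R)
          = -(((2 * C - 1) * x s + C * p) ^ 2 / ((2 * C - 1) * B)) - (y s) ^ 2 - (z s - 1) ^ 2 := by
        rw [hR]
        have := hk.ne'
        field_simp
        ring
      rw [e]
      have h1 : 0 ≤ ((2 * C - 1) * x s + C * p) ^ 2 / ((2 * C - 1) * B) := by positivity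
      nlinarith [sq_nonneg (y s), sq_nonneg (z s - 1)]
  have h := hanti (Set.self_mem_Ici) (Set.mem_Ici.2 ht) ht
  simp only [Real.exp_zero, mul_one] at h
  have h2 : ((x t) ^ 2 / B + (y t) ^ 2 + (z t + 1) ^ 2 - R) * Real.exp t ≤ 0 := by linarith
  have h3 := nonpos_of_mul_nonpos_left h2 (Real.exp_pos t)
  linarith
end
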